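/- (Diestel–Jarchow–Tonge, cotype 2 case) Let E and F be Banach spaces with E of cotype 2. Then a continuous linear operator u : E → F is absolutely (2,2)-summing if and only if it is absolutely (1,1)-summing. -/

import Mathlib

open scoped ENNReal NNReal BigOperators ZeroAtInfty

noncomputable section

/-- The `k`-th Rademacher function on `[0,1]`. -/
def Rademacher (k : ℕ) (t : ℝ) : ℝ := (-1 : ℝ) ^ ⌊(2 : ℝ) ^ (k + 1) * t⌋

/-- A Banach space `E` has cotype `q` (for `2 ≤ q < ∞`). -/
def HasCotype (q : ℝ) (E : Type*) [NormedAddCommGroup E] [NormedSpace ℝ E] : Prop :=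
  2 ≤ q ∧ ∃ C > 0, ∀ (n : ℕ) (x : Fin n → E),
    (∑ k : Fin n, ‖x k‖ ^ q) ^ (1 / q) ≤
      C * (∫ t in (0:ℝ)..(1:ℝ), ‖∑ k : Fin n, Rademacher k.1 t • x k‖ ^ 2) ^ ((1:ℝ) / 2)

/-- `cot E`, the infimum of the cotypes of `E` (`∞` if `E` has no finite cotype). -/
def cot (E : Type*) [NormedAddCommGroup E] [NormedSpace ℝ E] : ℝ≥0∞ :=
  sInf {c : ℝ≥0∞ | ∃ q : ℝ, HasCotype q E ∧ c = ENNReal.ofReal q}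

/-- Conjugate exponent in `ℝ≥0∞` : `p* = p/(p-1)`, with `1* = ∞` and `∞* = 1`. -/
def conjE (p : ℝ≥0∞) : ℝ≥0∞ := 1 + 1 / (p - 1)

/-- A sequence is weakly `p`-summable. -/
def WeaklySummable {E : Type*} [NormedAddCommGroup E] [NormedSpace ℝ E]
    (p : ℝ) (x : ℕ → E) : Prop :=
  ∀ φ : E →L[ℝ] ℝ, Summable fun j => |φ (x j)| ^ p

/-- `u : E → F` is absolutely `(q,p)`-summing. -/
def AbsolutelySumming {E F : Type*} [NormedAddCommGroup E] [NormedSpace ℝ E]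
    [NormedAddCommGroup F] [NormedSpace ℝ F] (q p : ℝ) (u : E →L[ℝ] F) : Prop :=
  ∀ x : ℕ → E, WeaklySummable p x → Summable fun j => ‖u (x j)‖ ^ q

/-- The weak `ℓ_p` norm of a sequence. -/
def weakNorm {E : Type*} [NormedAddCommGroup E] [NormedSpace ℝ E] (p : ℝ) (x : ℕ → E) : ℝ :=
  ⨆ φ : {φ : E →L[ℝ] ℝ // ‖φ‖ ≤ 1}, (∑' j, |φ.1 (x j)| ^ p) ^ (1 / p)

/-- A continuous `m`-linear operator is multiple `(q,p)`-summing. -/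
def MultipleSumming {m : ℕ} {E : Fin m → Type*} [∀ i, NormedAddCommGroup (E i)]
    [∀ i, NormedSpace ℝ (E i)] {F : Type*} [NormedAddCommGroup F] [NormedSpace ℝ F]
    (q p : ℝ) (T : ContinuousMultilinearMap ℝ E F) : Prop :=
  ∃ C > 0, ∀ x : (i : Fin m) → ℕ → E i, (∀ i, WeaklySummable p (x i)) →
    (Summable fun j : Fin m → ℕ => ‖T (fun i => x i (j i))‖ ^ q) ∧
    (∑' j : Fin m → ℕ, ‖T (fun i => x i (j i))‖ ^ q) ^ (1 / q) ≤
      C * ∏ i, weakNorm p (x i)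

open MeasureTheory

lemma Rademacher_zero_of_lt {t : ℝ} (h0 : 0 ≤ t) (h1 : t < 1 / 2) : Rademacher 0 t = 1 := by
  have : ⌊(2 : ℝ) ^ (0 + 1) * t⌋ = 0 := by
    rw [Int.floor_eq_iff]; constructor <;> norm_num <;> linarith
  rw [Rademacher, this, zpow_zero]

lemma Rademacher_zero_of_ge {t : ℝ} (h0 : 1 / 2 ≤ t) (h1 : t < 1) : Rademacher 0 t = -1 := by
  have : ⌊(2 : ℝ) ^ (0 + 1) * t⌋ = 1 := by
    rw [Int.floor_eq_iff]; constructor <;> norm_num <;> linarith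
  rw [Rademacher, this, zpow_one]

lemma Rademacher_succ (k : ℕ) (t : ℝ) : Rademacher (k + 1) t = Rademacher k (2 * t) := by
  rw [Rademacher, Rademacher, pow_succ _ (k + 1), mul_assoc]

lemma Rademacher_sub_one (k : ℕ) (t : ℝ) : Rademacher k (t - 1) = Rademacher k t := by
  have : (2 : ℝ) ^ (k + 1) * (t - 1) = 2 ^ (k + 1) * t - ((2 ^ (k + 1) : ℕ) : ℤ) := by
    push_cast; ring
  rw [Rademacher, Rademacher, this, Int.floor_sub_intCast, zpow_sub₀ (by norm_num)]
  rw [zpow_natCast, Even.neg_one_pow (by rw [pow_succ]; exact even_two.mul_left _), div_one]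

lemma measurable_Rademacher (k : ℕ) : Measurable (Rademacher k) :=
  (measurable_of_countable fun n : ℤ => (-1 : ℝ) ^ n).comp
    (Int.measurable_floor.comp (measurable_const_mul _))

lemma abs_Rademacher (k : ℕ) (t : ℝ) : |Rademacher k t| = 1 := by
  rw [Rademacher, abs_zpow, abs_neg, abs_one, one_zpow]

lemma norm_sum_Rademacher_smul_le {E : Type*} [NormedAddCommGroup E] [NormedSpace ℝ E] {n : ℕ}
    (x : Fin n → E) (t : ℝ) : ‖∑ k, Rademacher k.1 t • x k‖ ≤ ∑ k, ‖x k‖ :=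
  (norm_sum_le _ _).trans_eq <| Finset.sum_congr rfl fun k _ => by
    rw [norm_smul, Real.norm_eq_abs, abs_Rademacher, one_mul]

lemma intervalIntegrable_comp_sum_Rademacher {E : Type*} [NormedAddCommGroup E] [NormedSpace ℝ E]
    {n : ℕ} (x : Fin n → E) {f : E → ℝ} (hf : Continuous f) {B : ℝ}
    (hB : ∀ y, ‖y‖ ≤ ∑ k, ‖x k‖ → ‖f y‖ ≤ B) (a b : ℝ) :
    IntervalIntegrable (fun t => f (∑ k : Fin n, Rademacher k.1 t • x k)) volume a b := by
  have hs : StronglyMeasurable fun t => ∑ k : Fin n, Rademacher k.1 t • x k :=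
    Finset.stronglyMeasurable_fun_sum _ fun k _ =>
      (measurable_Rademacher k.1).stronglyMeasurable.smul_const (x k)
  rw [intervalIntegrable_iff]
  refine Measure.integrableOn_of_bounded (M := B) (by simp)
    (hf.comp_stronglyMeasurable hs).aestronglyMeasurable ?_
  exact Filter.Eventually.of_forall fun t => hB _ (norm_sum_Rademacher_smul_le x t)

lemma intervalIntegrable_add_sum_Rademacher_pow {n : ℕ} (c : Fin n → ℝ) (d : ℝ) (p : ℕ) (a b : ℝ) :
    IntervalIntegrable (fun t => (d + ∑ k, c k * Rademacher k.1 t) ^ p) volume a b := by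
  have := intervalIntegrable_comp_sum_Rademacher c (f := fun y => (d + y) ^ p) (by fun_prop)
    (B := (|d| + ∑ k, ‖c k‖) ^ p) (fun y hy => by
      rw [norm_pow]
      gcongr
      exact (norm_add_le _ _).trans (by gcongr; simp)) a b
  simpa [mul_comm] using this

/-- Khinchine's inequality for the fourth moment. -/
lemma integral_add_sum_Rademacher_pow_four_le {n : ℕ} (c : Fin n → ℝ) (d : ℝ) :
    ∫ t in (0:ℝ)..1, (d + ∑ k, c k * Rademacher k.1 t) ^ 4 ≤
      d ^ 4 + 6 * d ^ 2 * ∑ k, c k ^ 2 + 3 * (∑ k, c k ^ 2) ^ 2 := by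
  induction n generalizing d with
  | zero => simp
  | succ n ih =>
    set g : ℝ → ℝ → ℝ := fun d t => (d + ∑ k : Fin n, c k.succ * Rademacher k.1 t) ^ 4
    have h1 : ∫ t in (0:ℝ)..(1 / 2), (d + ∑ k, c k * Rademacher k.1 t) ^ 4 =
        (1 / 2) * ∫ t in (0:ℝ)..1, g (d + c 0) t := by
      have e : ∫ t in (0:ℝ)..(1 / 2), (d + ∑ k, c k * Rademacher k.1 t) ^ 4 =
          ∫ t in (0:ℝ)..(1 / 2), g (d + c 0) (2 * t) := by
        refine intervalIntegral.integral_congr_Ioo_of_le (by norm_num) fun t ht => ?_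
        simp only [g, Fin.sum_univ_succ, Fin.val_zero, Fin.val_succ, Rademacher_succ,
          Rademacher_zero_of_lt ht.1.le ht.2]
        ring
      rw [e, intervalIntegral.integral_comp_mul_left _ (by norm_num)]
      norm_num
    have h2 : ∫ t in (1 / 2 : ℝ)..1, (d + ∑ k, c k * Rademacher k.1 t) ^ 4 =
        (1 / 2) * ∫ t in (0:ℝ)..1, g (d - c 0) t := by
      have e : ∫ t in (1 / 2 : ℝ)..1, (d + ∑ k, c k * Rademacher k.1 t) ^ 4 =
          ∫ t in (1 / 2 : ℝ)..1, g (d - c 0) (2 * t - 1) := by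
        refine intervalIntegral.integral_congr_Ioo_of_le (by norm_num) fun t ht => ?_
        simp only [g, Fin.sum_univ_succ, Fin.val_zero, Fin.val_succ, Rademacher_succ,
          Rademacher_sub_one, Rademacher_zero_of_ge ht.1.le ht.2]
        ring
      rw [e, intervalIntegral.integral_comp_mul_sub _ (by norm_num)]
      norm_num
    have hi := fun a b => intervalIntegrable_add_sum_Rademacher_pow c d 4 a b
    rw [← intervalIntegral.integral_add_adjacent_intervals (hi 0 (1 / 2)) (hi (1 / 2) 1), h1, h2,
      Fin.sum_univ_succ]
    have h3 := ih (fun k => c k.succ) (d + c 0)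
    have h4 := ih (fun k => c k.succ) (d - c 0)
    simp only [g]
    nlinarith [sq_nonneg (c 0 ^ 2)]

/-- If every nonnegative functional strictly separates a value of `f` from `c`, then some convex
combination of values of `f` exceeds `c` in every coordinate. -/
lemma exists_convex_combination_gt {ι B : Type*} [Fintype ι] [Nonempty B] (f : B → ι → ℝ)
    (c : ι → ℝ)
    (h : ∀ t : ι → ℝ, (∀ i, 0 ≤ t i) → t ≠ 0 → ∃ b, ∑ i, t i * c i < ∑ i, t i * f b i) :
    ∃ (M : ℕ) (w : Fin M → ℝ) (b : Fin M → B), (∀ m, 0 ≤ w m) ∧ ∑ m, w m = 1 ∧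
      ∀ i, c i < ∑ m, w m * f (b m) i := by
  classical
  set O : Set (ι → ℝ) := Set.pi Set.univ fun i => Set.Ioi (c i)
  by_cases hd : Disjoint O (convexHull ℝ (Set.range f))
  · exfalso
    obtain ⟨L, r, hL1, hL2⟩ := geometric_hahn_banach_open
      (convex_pi fun i _ => convex_Ioi (c i)) (isOpen_set_pi Set.finite_univ fun i _ => isOpen_Ioi)
      (convex_convexHull ℝ _) hd
    have hL : ∀ y : ι → ℝ, L y = ∑ i, y i * L (Pi.single i 1) := fun y => by
      conv_lhs => rw [pi_eq_sum_univ' y]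
      simp [map_sum]
    have hc : ∀ d : ι → ℝ, (∀ i, 0 ≤ d i) → L c + L d ≤ r := fun d hd => by
      have hlim : Filter.Tendsto (fun s : ℝ => L (c + d + s • 1)) (nhdsWithin 0 (Set.Ioi 0))
          (nhds (L (c + d + (0 : ℝ) • 1))) :=
        ((by fun_prop : Continuous fun s : ℝ => L (c + d + s • 1)).tendsto 0).mono_left
          nhdsWithin_le_nhds
      rw [zero_smul, add_zero, map_add] at hlim
      refine le_of_tendsto hlim ?_
      filter_upwards [self_mem_nhdsWithin] with s hs
      refine (hL1 _ fun i _ => ?_).le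
      have := hd i
      simp only [Set.mem_Ioi, Pi.add_apply, Pi.smul_apply, Pi.one_apply, smul_eq_mul] at hs ⊢
      linarith
    have ht : ∀ i, 0 ≤ -L (Pi.single i 1) := fun i => by
      by_contra! hi
      obtain ⟨n, hn⟩ := exists_nat_gt ((r - L c) / L (Pi.single i 1))
      rw [div_lt_iff₀ (by linarith)] at hn
      have := hc ((n : ℝ) • Pi.single i 1) fun j => by
        simp only [Pi.smul_apply, smul_eq_mul, Pi.single_apply]; positivity
      rw [map_smul, smul_eq_mul] at this
      linarith
    have hne : (fun i => -L (Pi.single i 1)) ≠ 0 := fun h0 => by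
      have h0' : ∀ y, L y = 0 := fun y => by
        rw [hL]
        refine Finset.sum_eq_zero fun i _ => ?_
        have := congrFun h0 i
        simp only [Pi.zero_apply, neg_eq_zero] at this
        rw [this, mul_zero]
      have h1 := hL1 (c + 1) fun i _ => by simp
      have h2 := hL2 _ (subset_convexHull ℝ _ ⟨Classical.arbitrary B, rfl⟩)
      rw [h0'] at h1 h2
      linarith
    obtain ⟨b, hb⟩ := h _ ht hne
    have h1 := hc 0 fun _ => le_rfl
    have h2 := hL2 _ (subset_convexHull ℝ _ ⟨b, rfl⟩)
    rw [map_zero, add_zero, hL] at h1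
    rw [hL] at h2
    simp only [neg_mul, Finset.sum_neg_distrib, mul_comm (L _)] at hb
    linarith
  · obtain ⟨y, hyO, hy⟩ := Set.not_disjoint_iff.1 hd
    obtain ⟨κ, _, w, z, hw, hw1, hz, rfl⟩ := mem_convexHull_iff_exists_fintype.1 hy
    choose b hb using hz
    let e := (Fintype.equivFin κ).symm
    refine ⟨Fintype.card κ, w ∘ e, b ∘ e, fun m => hw _, ?_, fun i => ?_⟩
    · rw [← hw1]; exact e.sum_comp w
    · have := hyO i trivial
      simp only [Finset.sum_apply, Pi.smul_apply, smul_eq_mul, Set.mem_Ioi] at this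
      refine this.trans_eq ?_
      rw [← e.sum_comp]
      simp [hb]

/-- The inequality defining cotype 2, with squares in place of real powers. -/
lemma HasCotype.exists_sum_sq_le {E : Type*} [NormedAddCommGroup E] [NormedSpace ℝ E]
    (h : HasCotype 2 E) : ∃ C > 0, ∀ (n : ℕ) (x : Fin n → E),
      ∑ k, ‖x k‖ ^ 2 ≤
        C ^ 2 * ∫ t in (0:ℝ)..1, ‖∑ k : Fin n, Rademacher k.1 t • x k‖ ^ 2 := by
  obtain ⟨-, C, hC, h⟩ := h
  refine ⟨C, hC, fun n x => ?_⟩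
  have := h n x
  simp only [Real.rpow_two, ← Real.sqrt_eq_rpow] at this
  have hI : 0 ≤ ∫ t in (0:ℝ)..1, ‖∑ k : Fin n, Rademacher k.1 t • x k‖ ^ 2 :=
    intervalIntegral.integral_nonneg (by norm_num) fun t _ => by positivity
  rw [Real.sqrt_le_left (by positivity), mul_pow, Real.sq_sqrt hI] at this
  exact this

lemma sum_mul_abs_mul_abs_sq_le {ι : Type*} [Fintype ι] {t σ y g : ι → ℝ} {α R A : ℝ}
    (hα : 0 < α) (hR : 0 < R) (ht : ∀ i, 0 ≤ t i) (hσ : ∀ i, 0 < σ i)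
    (h : ∑ i, t i * (α * |y i| + y i ^ 2 / (4 * σ i)) ≤ A) :
    (∑ i, t i * (|y i| * |g i|)) ^ 2 ≤
      2 * (R / α) ^ 2 * A ^ 2 + 8 * A / R ^ 2 * ∑ i, t i * σ i * g i ^ 4 := by
  have e1 : ∑ i, t i * (α * |y i| + y i ^ 2 / (4 * σ i)) =
      α * ∑ i, t i * |y i| + (∑ i, t i * y i ^ 2 / σ i) / 4 := by
    rw [Finset.mul_sum, Finset.sum_div, ← Finset.sum_add_distrib]
    refine Finset.sum_congr rfl fun i _ => ?_
    have := (hσ i).ne'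
    field_simp
  rw [e1] at h
  have p1 : 0 ≤ ∑ i, t i * |y i| := Finset.sum_nonneg fun i _ => mul_nonneg (ht i) (abs_nonneg _)
  have p2 : 0 ≤ ∑ i, t i * y i ^ 2 / σ i := Finset.sum_nonneg fun i _ =>
    div_nonneg (mul_nonneg (ht i) (sq_nonneg _)) (hσ i).le
  have p3 : 0 ≤ ∑ i, t i * σ i * g i ^ 4 := Finset.sum_nonneg fun i _ =>
    mul_nonneg (mul_nonneg (ht i) (hσ i).le) (by positivity)
  have q1 : ∑ i, t i * (|y i| * |g i|) ≤
      R * ∑ i, t i * |y i| + (∑ i, t i * (|y i| * g i ^ 2)) / R := by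
    rw [Finset.mul_sum, Finset.sum_div, ← Finset.sum_add_distrib]
    refine Finset.sum_le_sum fun i _ => ?_
    have : |g i| ≤ R + g i ^ 2 / R := by
      rw [← sq_abs (g i), ← sub_nonneg]
      have : R + |g i| ^ 2 / R - |g i| = ((R - |g i|) ^ 2 + R * |g i|) / R := by
        field_simp; ring
      rw [this]; positivity
    calc t i * (|y i| * |g i|) ≤ t i * (|y i| * (R + g i ^ 2 / R)) := by
          have := ht i; gcongr
      _ = _ := by ring
  have q2 : (∑ i, t i * (|y i| * g i ^ 2)) ^ 2 ≤
      (∑ i, t i * y i ^ 2 / σ i) * ∑ i, t i * σ i * g i ^ 4 := by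
    refine Finset.sum_sq_le_sum_mul_sum_of_sq_le_mul _
      (fun i _ => div_nonneg (mul_nonneg (ht i) (sq_nonneg _)) (hσ i).le)
      (fun i _ => mul_nonneg (mul_nonneg (ht i) (hσ i).le) (by positivity)) fun i _ => le_of_eq ?_
    have := (hσ i).ne'
    rw [mul_pow, mul_pow, sq_abs]
    field_simp
  have p4 : 0 ≤ ∑ i, t i * (|y i| * |g i|) := Finset.sum_nonneg fun i _ =>
    mul_nonneg (ht i) (by positivity)
  set U := ∑ i, t i * |y i|
  set V := ∑ i, t i * y i ^ 2 / σ i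
  set Y := ∑ i, t i * σ i * g i ^ 4
  set W := ∑ i, t i * (|y i| * g i ^ 2)
  have hA : 0 ≤ A := le_trans (by positivity) h
  have hU : R * U ≤ R / α * A := by
    rw [div_mul_eq_mul_div, le_div_iff₀ hα]
    nlinarith
  calc _ ≤ (R * U + W / R) ^ 2 := by gcongr
    _ ≤ 2 * (R * U) ^ 2 + 2 * (W / R) ^ 2 := by nlinarith [sq_nonneg (R * U - W / R)]
    _ ≤ 2 * (R / α * A) ^ 2 + 2 * (4 * A * Y / R ^ 2) := by
        rw [div_pow]
        gcongr
        nlinarith [mul_nonneg hα.le p1]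
    _ = _ := by ring

/-- For a discrete probability measure `∑ w m δ_(φ m)` on the dual ball of a space satisfying the
cotype 2 inequality, the `L²` norms of a weighted finite family are controlled by the values of the
family at one functional. -/
lemma exists_dual_sum_lt {E : Type*} [NormedAddCommGroup E] [NormedSpace ℝ E] {C : ℝ} (hC : 0 < C)
    (hcot : ∀ (n : ℕ) (x : Fin n → E), ∑ k, ‖x k‖ ^ 2 ≤
      C ^ 2 * ∫ t in (0:ℝ)..1, ‖∑ k : Fin n, Rademacher k.1 t • x k‖ ^ 2)
    {M : ℕ} {w : Fin M → ℝ} {φ : Fin M → E →L[ℝ] ℝ} (hw : ∀ m, 0 ≤ w m) (hw1 : ∑ m, w m = 1)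
    (hφ : ∀ m, ‖φ m‖ ≤ 1) {ι : Type*} [Fintype ι] {x : ι → E} {σ : ι → ℝ} (hσ : ∀ i, 0 < σ i)
    (hσx : ∀ i, σ i ^ 2 = ∑ m, w m * φ m (x i) ^ 2) {t : ι → ℝ} (ht : ∀ i, 0 ≤ t i) (ht0 : t ≠ 0) :
    ∃ ψ : E →L[ℝ] ℝ, ‖ψ‖ ≤ 1 ∧
      ∑ i, t i * σ i < ∑ i, t i * (20 * C ^ 2 * |ψ (x i)| + ψ (x i) ^ 2 / (4 * σ i)) := by
  by_contra! h
  set A := ∑ i, t i * σ i with hA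
  have hApos : 0 < A := by
    obtain ⟨i, hi⟩ := Function.ne_iff.1 ht0
    exact Finset.sum_pos' (fun i _ => mul_nonneg (ht i) (hσ i).le)
      ⟨i, Finset.mem_univ _, mul_pos (lt_of_le_of_ne (ht i) (Ne.symm hi)) (hσ i)⟩
  set z : Fin M → E := fun m => ∑ i, (t i / σ i * φ m (x i)) • x i with hz
  set G : ι → ℝ → ℝ := fun i s => ∑ m : Fin M, √(w m) * φ m (x i) * Rademacher m.1 s with hG
  have hAz : A ^ 2 ≤ ∑ m, ‖√(w m) • z m‖ ^ 2 := by
    have e : A = ∑ m, w m * φ m (z m) := by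
      simp only [hz, map_sum, map_smul, smul_eq_mul, Finset.mul_sum]
      rw [Finset.sum_comm, hA]
      refine Finset.sum_congr rfl fun i _ => ?_
      have : t i * σ i = t i / σ i * σ i ^ 2 := by have := (hσ i).ne'; field_simp
      rw [this, hσx, Finset.mul_sum]
      exact Finset.sum_congr rfl fun m _ => by ring
    rw [e]
    calc _ ≤ (∑ m, w m) * ∑ m, ‖√(w m) • z m‖ ^ 2 := by
          refine Finset.sum_sq_le_sum_mul_sum_of_sq_le_mul _ (fun m _ => hw m)
            (fun m _ => by positivity) fun m _ => ?_
          rw [norm_smul, mul_pow, mul_pow, Real.norm_eq_abs, sq_abs, Real.sq_sqrt (hw m), sq (w m),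
            mul_assoc]
          have h1 : φ m (z m) ^ 2 ≤ ‖z m‖ ^ 2 := by
            rw [← sq_abs]
            gcongr
            simpa using (φ m).le_of_opNorm_le (hφ m) (z m)
          have := hw m
          gcongr
      _ = _ := by rw [hw1, one_mul]
  have hsum : ∀ s, ∑ m : Fin M, Rademacher m.1 s • √(w m) • z m =
      ∑ i, (t i * (G i s / σ i)) • x i := fun s => by
    simp only [hz, hG, Finset.smul_sum, smul_smul, Finset.sum_div, Finset.mul_sum, Finset.sum_smul]
    rw [Finset.sum_comm]
    refine Finset.sum_congr rfl fun i _ => Finset.sum_congr rfl fun m _ => ?_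
    congr 1
    ring
  have hpt : ∀ s, ‖∑ m : Fin M, Rademacher m.1 s • √(w m) • z m‖ ^ 2 ≤
      2 * (10 * C / (20 * C ^ 2)) ^ 2 * A ^ 2 +
        8 * A / (10 * C) ^ 2 * ∑ i, t i * σ i * (G i s / σ i) ^ 4 := fun s => by
    obtain ⟨ψ, hψ, hψe⟩ := exists_dual_vector'' ℝ (∑ m : Fin M, Rademacher m.1 s • √(w m) • z m)
    refine le_trans ?_ (sum_mul_abs_mul_abs_sq_le (y := fun i => ψ (x i)) (by positivity)
      (by positivity) ht hσ (h ψ hψ))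
    gcongr
    rw [RCLike.ofReal_real_eq_id, id] at hψe
    rw [← hψe, hsum, map_sum]
    refine Finset.sum_le_sum fun i _ => ?_
    rw [map_smul, smul_eq_mul, mul_assoc, mul_comm |_|, ← abs_mul]
    exact mul_le_mul_of_nonneg_left (le_abs_self _) (ht i)
  have hGint : ∀ i, IntervalIntegrable (fun s => t i * σ i * (G i s / σ i) ^ 4) volume 0 1 :=
    fun i => by
      have := (intervalIntegrable_add_sum_Rademacher_pow
        (fun m => √(w m) * φ m (x i)) 0 4 0 1).const_mul (t i * σ i / σ i ^ 4)
      simp only [zero_add] at this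
      refine this.congr fun s _ => ?_
      simp only [hG]
      ring
  have hG4 : ∀ i, ∫ s in (0:ℝ)..1, t i * σ i * (G i s / σ i) ^ 4 ≤ 3 * (t i * σ i) := fun i => by
    have h4 := integral_add_sum_Rademacher_pow_four_le (fun m => √(w m) * φ m (x i)) 0
    have e : ∑ m, (√(w m) * φ m (x i)) ^ 2 = σ i ^ 2 := by
      rw [hσx]
      exact Finset.sum_congr rfl fun m _ => by rw [mul_pow, Real.sq_sqrt (hw m)]
    simp only [zero_add] at h4
    rw [e] at h4
    have hσi := hσ i
    have hti := ht i
    calc _ = ∫ s in (0:ℝ)..1, (t i * σ i / σ i ^ 4) * G i s ^ 4 := by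
          congr 1; ext s; ring
      _ = (t i * σ i / σ i ^ 4) * ∫ s in (0:ℝ)..1, G i s ^ 4 := by
          rw [intervalIntegral.integral_const_mul]
      _ ≤ (t i * σ i / σ i ^ 4) * (3 * σ i ^ 4) := by
          gcongr
          refine h4.trans_eq ?_
          ring
      _ = _ := by field_simp
  have hI : ∫ s in (0:ℝ)..1, ‖∑ m : Fin M, Rademacher m.1 s • √(w m) • z m‖ ^ 2 ≤
      2 * (10 * C / (20 * C ^ 2)) ^ 2 * A ^ 2 + 8 * A / (10 * C) ^ 2 * (3 * A) := by
    have hsi : IntervalIntegrable (fun s => ∑ i, t i * σ i * (G i s / σ i) ^ 4) volume 0 1 := by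
      have := IntervalIntegrable.sum Finset.univ fun i _ => hGint i
      simpa [Finset.sum_fn] using this
    refine (intervalIntegral.integral_mono_on (by norm_num)
      (intervalIntegrable_comp_sum_Rademacher _ (f := fun y => ‖y‖ ^ 2) (by fun_prop)
        (B := (∑ m, ‖√(w m) • z m‖) ^ 2) (fun y hy => ?_) _ _)
      ((intervalIntegrable_const).add (hsi.const_mul _)) fun s _ => hpt s).trans ?_
    · rw [norm_pow, norm_norm]; gcongr
    · rw [intervalIntegral.integral_add intervalIntegrable_const (hsi.const_mul _),
        intervalIntegral.integral_const_mul (8 * A / (10 * C) ^ 2),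
        intervalIntegral.integral_finsetSum fun i _ => hGint i]
      simp only [intervalIntegral.integral_const, sub_zero, one_smul]
      gcongr
      rw [hA, Finset.mul_sum]
      exact Finset.sum_le_sum fun i _ => hG4 i
  have hfin := hAz.trans ((hcot M _).trans (mul_le_mul_of_nonneg_left hI (sq_nonneg C)))
  have : C ^ 2 * (2 * (10 * C / (20 * C ^ 2)) ^ 2 * A ^ 2 + 8 * A / (10 * C) ^ 2 * (3 * A)) =
      (74 / 100) * A ^ 2 := by
    field_simp
    ring
  rw [this] at hfin
  nlinarith [pow_pos hApos 2]

lemma sum_sqrt_le_iterate {E : Type*} [NormedAddCommGroup E] [NormedSpace ℝ E] {C : ℝ}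
    (hC : 0 < C) (hcot : ∀ (n : ℕ) (x : Fin n → E), ∑ k, ‖x k‖ ^ 2 ≤
      C ^ 2 * ∫ t in (0:ℝ)..1, ‖∑ k : Fin n, Rademacher k.1 t • x k‖ ^ 2)
    (n : ℕ) {M : ℕ} {w : Fin M → ℝ} {φ : Fin M → E →L[ℝ] ℝ} (hw : ∀ m, 0 ≤ w m)
    (hw1 : ∑ m, w m = 1) (hφ : ∀ m, ‖φ m‖ ≤ 1) {ι : Type*} [Fintype ι] {x : ι → E} {W : ℝ}
    (hW : ∀ ψ : E →L[ℝ] ℝ, ‖ψ‖ ≤ 1 → ∑ i, |ψ (x i)| ≤ W) :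
    ∑ i, √(∑ m, w m * φ m (x i) ^ 2) ≤ (40 * C ^ 2 + Fintype.card ι / 2 ^ n) * W := by
  classical
  have hW0 : 0 ≤ W := by simpa using hW 0 (by simp)
  induction n generalizing M ι with
  | zero =>
    calc _ ≤ ∑ _i : ι, W := by
          refine Finset.sum_le_sum fun i _ => Real.sqrt_le_iff.2 ⟨hW0, ?_⟩
          calc _ ≤ ∑ m, w m * W ^ 2 := by
                refine Finset.sum_le_sum fun m _ => mul_le_mul_of_nonneg_left ?_ (hw m)
                rw [← sq_abs]
                gcongr
                exact (Finset.single_le_sum (f := fun i => |φ m (x i)|)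
                  (fun _ _ => abs_nonneg _) (Finset.mem_univ i)).trans (hW _ (hφ m))
            _ = W ^ 2 := by rw [← Finset.sum_mul, hw1, one_mul]
      _ = Fintype.card ι * W := by simp
      _ ≤ _ := by
          rw [pow_zero, div_one]
          gcongr
          have := sq_nonneg C
          linarith
  | succ n ih =>
    set σ : ι → ℝ := fun i => √(∑ m, w m * φ m (x i) ^ 2)
    have hsub : ∀ f : ι → ℝ, ∑ i : {i // 0 < σ i}, f i = ∑ i with 0 < σ i, f i := fun f =>
      (Finset.sum_subtype _ (by simp) f).symm
    have hsplit : ∑ i, σ i = ∑ i : {i // 0 < σ i}, σ i := by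
      rw [hsub, Finset.sum_filter_of_ne]
      exact fun i _ hi => lt_of_le_of_ne (Real.sqrt_nonneg _) hi.symm
    have hW' : ∀ ψ : E →L[ℝ] ℝ, ‖ψ‖ ≤ 1 → ∑ i : {i // 0 < σ i}, |ψ (x i)| ≤ W := fun ψ hψ => by
      refine le_trans ?_ (hW ψ hψ)
      rw [hsub fun i => |ψ (x i)|]
      exact Finset.sum_le_sum_of_subset_of_nonneg (Finset.filter_subset _ _)
        fun _ _ _ => abs_nonneg _
    have : Nonempty {ψ : E →L[ℝ] ℝ // ‖ψ‖ ≤ 1} := ⟨0, by simp⟩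
    obtain ⟨M', w', ψ, hw', hw1', hgt⟩ := exists_convex_combination_gt
      (fun (ψ : {ψ : E →L[ℝ] ℝ // ‖ψ‖ ≤ 1}) (i : {i // 0 < σ i}) =>
        20 * C ^ 2 * |ψ.1 (x i)| + ψ.1 (x i) ^ 2 / (4 * σ i)) (fun i => σ i) fun t ht ht0 => by
          obtain ⟨ψ, hψ, h⟩ := exists_dual_sum_lt hC hcot hw hw1 hφ
            (x := fun i : {i // 0 < σ i} => x i) (σ := fun i : {i // 0 < σ i} => σ i) (fun i => i.2)
            (fun i => Real.sq_sqrt (Finset.sum_nonneg fun m _ =>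
              mul_nonneg (hw m) (sq_nonneg _))) ht ht0
          exact ⟨⟨ψ, hψ⟩, h⟩
    have hih := ih (φ := fun m => (ψ m).1) hw' hw1' (fun m => (ψ m).2) hW'
    have hσ : ∀ i : {i // 0 < σ i}, σ i ≤ 20 * C ^ 2 * ∑ m, w' m * |(ψ m).1 (x i)| +
        √(∑ m, w' m * (ψ m).1 (x i) ^ 2) / 2 := fun i => by
      have h := hgt i
      have e : ∑ m, w' m * (20 * C ^ 2 * |(ψ m).1 (x i)| + (ψ m).1 (x i) ^ 2 / (4 * σ i)) =
          20 * C ^ 2 * ∑ m, w' m * |(ψ m).1 (x i)| +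
            (∑ m, w' m * (ψ m).1 (x i) ^ 2) / (4 * σ i) := by
        rw [Finset.mul_sum, Finset.sum_div, ← Finset.sum_add_distrib]
        exact Finset.sum_congr rfl fun m _ => by ring
      rw [e] at h
      have hT : 0 ≤ ∑ m, w' m * (ψ m).1 (x i) ^ 2 :=
        Finset.sum_nonneg fun m _ => mul_nonneg (hw' m) (sq_nonneg _)
      have hU : 0 ≤ 20 * C ^ 2 * ∑ m, w' m * |(ψ m).1 (x i)| :=
        mul_nonneg (by positivity) (Finset.sum_nonneg fun m _ => mul_nonneg (hw' m) (abs_nonneg _))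
      have hs := Real.sq_sqrt hT
      have hs0 := Real.sqrt_nonneg (∑ m, w' m * (ψ m).1 (x i) ^ 2)
      set T := ∑ m, w' m * (ψ m).1 (x i) ^ 2
      set U := 20 * C ^ 2 * ∑ m, w' m * |(ψ m).1 (x i)|
      have hi := i.2
      by_contra! hlt
      rw [← sub_lt_iff_lt_add', lt_div_iff₀ (by positivity)] at h
      nlinarith
    have hcard : (Fintype.card {i // 0 < σ i} : ℝ) ≤ Fintype.card ι := by
      exact_mod_cast Fintype.card_subtype_le _
    rw [hsplit]
    calc _ ≤ ∑ i : {i // 0 < σ i}, (20 * C ^ 2 * ∑ m, w' m * |(ψ m).1 (x i)| +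
        √(∑ m, w' m * (ψ m).1 (x i) ^ 2) / 2) := Finset.sum_le_sum fun i _ => hσ i
      _ = 20 * C ^ 2 * ∑ m, w' m * ∑ i : {i // 0 < σ i}, |(ψ m).1 (x i)| +
        (∑ i : {i // 0 < σ i}, √(∑ m, w' m * (ψ m).1 (x i) ^ 2)) / 2 := by
          rw [Finset.sum_add_distrib, ← Finset.mul_sum, Finset.sum_comm, Finset.sum_div]
          simp only [Finset.mul_sum]
      _ ≤ 20 * C ^ 2 * ∑ m, w' m * W +
        ((40 * C ^ 2 + Fintype.card ι / 2 ^ n) * W) / 2 := by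
          gcongr with m
          · exact hw' m
          · exact hW' _ (ψ m).2
          · exact hih.trans (by gcongr)
      _ = _ := by
          rw [← Finset.sum_mul, hw1', pow_succ]
          ring

/-- In a space satisfying the cotype 2 inequality, the sum of the `L²` norms of a finite family with
respect to a discrete probability measure on the dual ball is controlled by its weak `ℓ¹` norm. -/
lemma sum_sqrt_le {E : Type*} [NormedAddCommGroup E] [NormedSpace ℝ E] {C : ℝ}
    (hC : 0 < C) (hcot : ∀ (n : ℕ) (x : Fin n → E), ∑ k, ‖x k‖ ^ 2 ≤
      C ^ 2 * ∫ t in (0:ℝ)..1, ‖∑ k : Fin n, Rademacher k.1 t • x k‖ ^ 2)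
    {M : ℕ} {w : Fin M → ℝ} {φ : Fin M → E →L[ℝ] ℝ} (hw : ∀ m, 0 ≤ w m)
    (hw1 : ∑ m, w m = 1) (hφ : ∀ m, ‖φ m‖ ≤ 1) {ι : Type*} [Fintype ι] {x : ι → E} {W : ℝ}
    (hW : ∀ ψ : E →L[ℝ] ℝ, ‖ψ‖ ≤ 1 → ∑ i, |ψ (x i)| ≤ W) :
    ∑ i, √(∑ m, w m * φ m (x i) ^ 2) ≤ 40 * C ^ 2 * W := by
  have hlim : Filter.Tendsto (fun n : ℕ => (40 * C ^ 2 + Fintype.card ι / (2:ℝ) ^ n) * W)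
      Filter.atTop (nhds ((40 * C ^ 2 + 0) * W)) := by
    refine (tendsto_const_nhds.add ?_).mul_const W
    exact tendsto_const_nhds.div_atTop (tendsto_pow_atTop_atTop_of_one_lt (by norm_num))
  rw [add_zero] at hlim
  exact ge_of_tendsto' hlim fun n => sum_sqrt_le_iterate hC hcot n hw hw1 hφ hW

/-- A 2-summing operator satisfies a uniform inequality on finite families. -/
lemma AbsolutelySumming.exists_sum_sq_le {E F : Type*} [NormedAddCommGroup E] [NormedSpace ℝ E]
    [NormedAddCommGroup F] [NormedSpace ℝ F] {u : E →L[ℝ] F} (hu : AbsolutelySumming 2 2 u) :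
    ∃ K > 0, ∀ (k : ℕ) (x : Fin k → E) (S : ℝ),
      (∀ φ : E →L[ℝ] ℝ, ‖φ‖ ≤ 1 → ∑ i, φ (x i) ^ 2 ≤ S) → ∑ i, ‖u (x i)‖ ^ 2 ≤ K * S := by
  by_contra! hcon
  have hcon' : ∀ n : ℕ, ∃ (k : ℕ) (x : Fin k → E), (∑ i, ‖u (x i)‖ ^ 2 = 1) ∧
      ∀ φ : E →L[ℝ] ℝ, ‖φ‖ ≤ 1 → ∑ i, φ (x i) ^ 2 ≤ (1 / 2 : ℝ) ^ n := fun n => by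
    obtain ⟨k, x, S, hS, hlt⟩ := hcon (2 ^ n) (by positivity)
    have hS0 : 0 ≤ S := by simpa using hS 0 (by simp)
    have hpos : 0 < ∑ i, ‖u (x i)‖ ^ 2 := lt_of_le_of_lt (by positivity) hlt
    set ρ := ∑ i, ‖u (x i)‖ ^ 2 with hρ
    have hsq : (√ρ)⁻¹ ^ 2 = ρ⁻¹ := by rw [inv_pow, Real.sq_sqrt hpos.le]
    refine ⟨k, fun i => (√ρ)⁻¹ • x i, ?_, fun φ hφ => ?_⟩
    · simp only [map_smul, norm_smul, mul_pow, Real.norm_eq_abs, sq_abs, hsq]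
      rw [← Finset.mul_sum, ← hρ, inv_mul_cancel₀ hpos.ne']
    · simp only [map_smul, smul_eq_mul, mul_pow, hsq]
      rw [← Finset.mul_sum, one_div, inv_pow, inv_mul_le_iff₀ hpos, ← div_eq_mul_inv,
        le_div_iff₀ (by positivity)]
      have := hS φ hφ
      nlinarith [pow_pos (two_pos : (0:ℝ) < 2) n]
  choose k x hx1 hx2 using hcon'
  have hk : ∀ n, Nonempty (Fin (k n)) := fun n => by
    by_contra h
    rw [not_nonempty_iff] at h
    simpa using hx1 n
  have : Infinite (Σ n, Fin (k n)) :=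
    Infinite.of_surjective Sigma.fst fun n => ⟨⟨n, (hk n).some⟩, rfl⟩
  obtain ⟨hD⟩ := nonempty_denumerable (Σ n, Fin (k n))
  let e : ℕ ≃ Σ n, Fin (k n) := (Denumerable.eqv _).symm
  have hweak : WeaklySummable 2 fun j => x (e j).1 (e j).2 := fun φ => by
    simp only [Real.rpow_two, sq_abs]
    refine (e.summable_iff (f := fun p : Σ n, Fin (k n) => φ (x p.1 p.2) ^ 2)).2 ?_
    rw [summable_sigma_of_nonneg fun _ => sq_nonneg _]
    refine ⟨fun n => Summable.of_finite, ?_⟩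
    refine Summable.of_nonneg_of_le (fun n => tsum_nonneg fun _ => sq_nonneg _) (fun n => ?_)
      (summable_geometric_two.mul_left ((‖φ‖ + 1) ^ 2))
    have hpos : 0 < ‖φ‖ + 1 := by positivity
    have h := hx2 n ((‖φ‖ + 1)⁻¹ • φ) (by
      rw [norm_smul, norm_inv, Real.norm_of_nonneg hpos.le, inv_mul_le_one₀ hpos]
      linarith)
    simp only [_root_.smul_apply, smul_eq_mul, mul_pow, inv_pow] at h
    rwa [← Finset.mul_sum, inv_mul_le_iff₀ (by positivity), ← tsum_fintype (L := .unconditional _)]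
      at h
  have hs := hu _ hweak
  simp only [Real.rpow_two] at hs
  have hs' := (e.summable_iff (f := fun p : Σ n, Fin (k n) => ‖u (x p.1 p.2)‖ ^ 2)).1 hs
  have h1 := ((summable_sigma_of_nonneg fun _ => by positivity).1 hs').2
  simp only [tsum_fintype, hx1] at h1
  exact absurd h1 (by simp [summable_const_iff])

/-- A weakly summable sequence has finite weak `ℓ¹` norm. -/
lemma WeaklySummable.exists_sum_abs_le {E : Type*} [NormedAddCommGroup E] [NormedSpace ℝ E]
    {x : ℕ → E} (hx : WeaklySummable 1 x) :
    ∃ W, ∀ φ : E →L[ℝ] ℝ, ‖φ‖ ≤ 1 → ∀ s : Finset ℕ, ∑ i ∈ s, |φ (x i)| ≤ W := by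
  let g : Finset ℕ × (ℕ → SignType) → StrongDual ℝ (StrongDual ℝ E) := fun p =>
    NormedSpace.inclusionInDoubleDual ℝ E (∑ i ∈ p.1, (p.2 i : ℝ) • x i)
  have hg : ∀ p φ, g p φ = ∑ i ∈ p.1, (p.2 i : ℝ) * φ (x i) := fun p φ => by
    change φ (∑ i ∈ p.1, (p.2 i : ℝ) • x i) = _
    simp
  obtain ⟨W, hW⟩ := banach_steinhaus (g := g) fun φ => by
    have hφ : Summable fun j => |φ (x j)| := by simpa using hx φ
    refine ⟨∑' j, |φ (x j)|, fun p => ?_⟩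
    refine le_trans ?_ (hφ.sum_le_tsum p.1 fun _ _ => abs_nonneg _)
    rw [hg]
    refine (norm_sum_le _ _).trans (Finset.sum_le_sum fun i _ => ?_)
    rw [norm_mul, Real.norm_eq_abs, Real.norm_eq_abs]
    refine mul_le_of_le_one_left (abs_nonneg _) ?_
    cases p.2 i <;> simp
  refine ⟨W, fun φ hφ s => ?_⟩
  have h := (g (s, fun i => SignType.sign (φ (x i)))).le_of_opNorm_le (hW _) φ
  have hW0 : 0 ≤ W := (norm_nonneg _).trans (hW (∅, 0))
  refine le_trans ?_ (h.trans (mul_le_of_le_one_right hW0 hφ))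
  simp only [hg, sign_mul_self]
  exact le_abs_self _

lemma AbsolutelySumming.one_of_two {E F : Type*} [NormedAddCommGroup E] [NormedSpace ℝ E]
    [NormedAddCommGroup F] [NormedSpace ℝ F] (hcot : HasCotype 2 E) {u : E →L[ℝ] F}
    (hu : AbsolutelySumming 2 2 u) : AbsolutelySumming 1 1 u := by
  classical
  intro x hx
  obtain ⟨C, hC, hcot⟩ := hcot.exists_sum_sq_le
  obtain ⟨K, hK, hu⟩ := hu.exists_sum_sq_le
  obtain ⟨W, hW⟩ := hx.exists_sum_abs_le
  simp only [Real.rpow_one]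
  refine summable_of_sum_le (c := √(2 * K) * (40 * C ^ 2 * W)) (fun _ => norm_nonneg _) fun s => ?_
  rw [← Finset.sum_filter_ne_zero]
  set s' := s.filter fun i => ‖u (x i)‖ ≠ 0 with hs'
  let e := s'.equivFin.symm
  let y : Fin s'.card → E := fun i => x (e i)
  have hsum : ∀ f : ℕ → ℝ, ∑ i ∈ s', f i = ∑ i, f (e i) := fun f => by
    rw [← Finset.sum_coe_sort, ← e.sum_comp]
  have hy : ∀ i, 0 < ‖u (y i)‖ := fun i =>
    lt_of_le_of_ne (norm_nonneg _) (Ne.symm (Finset.mem_filter.1 (e i).2).2)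
  have : Nonempty {ψ : E →L[ℝ] ℝ // ‖ψ‖ ≤ 1} := ⟨0, by simp⟩
  obtain ⟨M, w, φ, hw, hw1, hgt⟩ := exists_convex_combination_gt
    (fun (ψ : {ψ : E →L[ℝ] ℝ // ‖ψ‖ ≤ 1}) i => ψ.1 (y i) ^ 2)
    (fun i => ‖u (y i)‖ ^ 2 / (2 * K)) fun t ht ht0 => by
      by_contra! hcon
      have h := hu _ (fun i => √(t i) • y i) (∑ i, t i * (‖u (y i)‖ ^ 2 / (2 * K))) fun ψ hψ => by
        refine le_trans (le_of_eq ?_) (hcon ⟨ψ, hψ⟩)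
        exact Finset.sum_congr rfl fun i _ => by
          rw [map_smul, smul_eq_mul, mul_pow, Real.sq_sqrt (ht i)]
      have e1 : ∑ i, ‖u (√(t i) • y i)‖ ^ 2 = ∑ i, t i * ‖u (y i)‖ ^ 2 :=
        Finset.sum_congr rfl fun i _ => by
          rw [map_smul, norm_smul, mul_pow, Real.norm_eq_abs, sq_abs, Real.sq_sqrt (ht i)]
      have e2 : K * ∑ i, t i * (‖u (y i)‖ ^ 2 / (2 * K)) = (∑ i, t i * ‖u (y i)‖ ^ 2) / 2 := by
        rw [Finset.mul_sum, Finset.sum_div]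
        exact Finset.sum_congr rfl fun i _ => by field_simp
      rw [e1, e2] at h
      obtain ⟨i, hi⟩ := Function.ne_iff.1 ht0
      have : 0 < ∑ i, t i * ‖u (y i)‖ ^ 2 :=
        Finset.sum_pos' (fun i _ => mul_nonneg (ht i) (sq_nonneg _)) ⟨i, Finset.mem_univ _,
          mul_pos (lt_of_le_of_ne (ht i) (Ne.symm hi)) (pow_pos (hy i) 2)⟩
      linarith
  have hfin := sum_sqrt_le hC hcot hw hw1 (fun m => (φ m).2) (x := y) (W := W) fun ψ hψ => by
    rw [← hsum fun i => |ψ (x i)|]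
    exact hW ψ hψ s'
  rw [hsum fun i => ‖u (x i)‖]
  refine le_trans ?_ (mul_le_mul_of_nonneg_left hfin (Real.sqrt_nonneg _))
  rw [Finset.mul_sum]
  refine Finset.sum_le_sum fun i _ => ?_
  rw [← Real.sqrt_mul (by positivity)]
  refine Real.le_sqrt_of_sq_le ?_
  have := hgt i
  rw [div_lt_iff₀ (by positivity)] at this
  linarith

/-- A form of the Abel–Dini theorem. -/
lemma summable_of_summable_div_one_add_sum {c : ℕ → ℝ} (hc : ∀ j, 0 ≤ c j)
    (h : Summable fun j => c j / (1 + ∑ i ∈ Finset.range (j + 1), c i)) : Summable c := by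
  set P : ℕ → ℝ := fun n => ∑ i ∈ Finset.range n, c i with hP
  have hP0 : ∀ n, 0 ≤ P n := fun n => Finset.sum_nonneg fun i _ => hc i
  have hmono : Monotone P := fun a b hab =>
    Finset.sum_le_sum_of_subset_of_nonneg (Finset.range_mono hab) fun i _ _ => hc i
  have hpos : ∀ j, 0 ≤ c j / (1 + P (j + 1)) := fun j =>
    div_nonneg (hc j) (by linarith [hP0 (j + 1)])
  obtain ⟨m, hm⟩ : ∃ m, ∑' j, c j / (1 + P (j + 1)) - 1 / 2 <
      ∑ j ∈ Finset.range m, c j / (1 + P (j + 1)) :=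
    (h.hasSum.tendsto_sum_nat.eventually (lt_mem_nhds (by linarith))).exists
  refine summable_of_sum_range_le (c := 1 + 2 * P m) hc fun n => ?_
  rcases le_total n m with hnm | hmn
  · linarith [hmono hnm, hP0 m]
  · have h1 : ∑ j ∈ Finset.Ico m n, c j / (1 + P (j + 1)) ≤ 1 / 2 := by
      have := h.sum_le_tsum (Finset.range n) fun j _ => hpos j
      rw [← Finset.sum_range_add_sum_Ico _ hmn] at this
      linarith
    have h2 : (P n - P m) / (1 + P n) ≤ ∑ j ∈ Finset.Ico m n, c j / (1 + P (j + 1)) := by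
      rw [hP, ← Finset.sum_Ico_eq_sub _ hmn, Finset.sum_div]
      refine Finset.sum_le_sum fun j hj => ?_
      have := hmono (Nat.succ_le_of_lt (Finset.mem_Ico.1 hj).2)
      have := hP0 (j + 1)
      exact div_le_div_of_nonneg_left (hc j) (by linarith) (by simpa [hP] using ‹P (j + 1) ≤ P n›)
    have h3 := h2.trans h1
    rw [div_le_iff₀ (by linarith [hP0 n])] at h3
    change P n ≤ _
    linarith

lemma summable_div_one_add_sum_sq {c : ℕ → ℝ} (hc : ∀ j, 0 ≤ c j) :
    Summable fun j => c j / (1 + ∑ i ∈ Finset.range (j + 1), c i) ^ 2 := by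
  set P : ℕ → ℝ := fun n => ∑ i ∈ Finset.range n, c i with hP
  have hP0 : ∀ n, 0 ≤ P n := fun n => Finset.sum_nonneg fun i _ => hc i
  refine summable_of_sum_range_le (c := 1) (fun j => div_nonneg (hc j) (sq_nonneg _)) fun n => ?_
  suffices h : ∑ j ∈ Finset.range n, c j / (1 + P (j + 1)) ^ 2 ≤ 1 - 1 / (1 + P n) by
    have : 0 ≤ 1 / (1 + P n) := by have := hP0 n; positivity
    exact h.trans (by linarith)
  induction n with
  | zero => simp [hP]
  | succ n ih =>
    rw [Finset.sum_range_succ]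
    have h1 : P (n + 1) = P n + c n := Finset.sum_range_succ _ _
    have h2 := hP0 n
    have h3 := hc n
    have : c n / (1 + P (n + 1)) ^ 2 ≤ 1 / (1 + P n) - 1 / (1 + P (n + 1)) := by
      rw [h1, div_sub_div _ _ (by positivity) (by positivity),
        div_le_div_iff₀ (by positivity) (by positivity)]
      have : 0 ≤ c n ^ 2 * (1 + (P n + c n)) := by positivity
      nlinarith
    linarith

lemma AbsolutelySumming.two_of_one {E F : Type*} [NormedAddCommGroup E] [NormedSpace ℝ E]
    [NormedAddCommGroup F] [NormedSpace ℝ F] {u : E →L[ℝ] F}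
    (hu : AbsolutelySumming 1 1 u) : AbsolutelySumming 2 2 u := by
  intro x hx
  simp only [Real.rpow_two]
  refine summable_of_summable_div_one_add_sum (fun j => sq_nonneg _) ?_
  have h2 := summable_div_one_add_sum_sq fun j => sq_nonneg ‖u (x j)‖
  set D : ℕ → ℝ := fun j => 1 + ∑ i ∈ Finset.range (j + 1), ‖u (x i)‖ ^ 2
  have hD : ∀ j, 0 < D j := fun j => by positivity
  have hs := hu (fun j => (‖u (x j)‖ / D j) • x j) fun φ => by
    have hφ := hx φ
    simp only [Real.rpow_two] at hφ
    simp only [Real.rpow_one]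
    refine Summable.of_nonneg_of_le (fun _ => abs_nonneg _) (fun j => ?_) (h2.add hφ)
    have e : ‖u (x j)‖ ^ 2 / D j ^ 2 = (‖u (x j)‖ / D j) ^ 2 := (div_pow _ _ _).symm
    have hn : 0 ≤ ‖u (x j)‖ / D j := div_nonneg (norm_nonneg _) (hD j).le
    rw [map_smul, smul_eq_mul, abs_mul, abs_of_nonneg hn, e]
    nlinarith [sq_nonneg (‖u (x j)‖ / D j - |φ (x j)|), sq_nonneg (‖u (x j)‖ / D j),
      sq_nonneg (|φ (x j)|)]
  simp only [Real.rpow_one] at hs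
  refine hs.congr fun j => ?_
  have hn : 0 ≤ ‖u (x j)‖ / D j := div_nonneg (norm_nonneg _) (hD j).le
  rw [map_smul, norm_smul, Real.norm_of_nonneg hn]
  ring

/-- Diestel–Jarchow–Tonge, cotype 2 case: if `E` has cotype 2 then
`Π₂(E;F) = Π₁(E;F)`. -/
theorem stmt17 (E F : Type*) [NormedAddCommGroup E] [NormedSpace ℝ E] [CompleteSpace E]
    [NormedAddCommGroup F] [NormedSpace ℝ F] [CompleteSpace F]
    (hcot : HasCotype 2 E) (u : E →L[ℝ] F) :
    AbsolutelySumming 2 2 u ↔ AbsolutelySumming 1 1 u := by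
  exact ⟨fun hu => hu.one_of_two hcot, fun hu => hu.two_of_one⟩

end
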